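/- Let ℓ ≥ 1 be an integer and let F ⊆ ℕ^ℓ be a finite set with k = |F| ≥ 3. For every i ∈ [k−1] there are constants K and n₀ such that for every n ≥ n₀ and every q ≥ n^{-1/(k-1)} the following holds for the k-uniform hypergraph H_n with vertex set V_n = [n]^ℓ whose edges are the homothetic copies of F in [n]^ℓ: μ_i(H_n, q) ≤ K·q^{2i}·n^{ℓ+2}. In particular, the sequence (H_n) is (K, (n^{-1/(k-1)})_{n∈ℕ})-bounded. -/

import Mathlib

open Finset Filter

/-- The probability weight of obtaining exactly the subset `S` when each element of the
finite ground set `Γ` is included independently with probability `p`. -/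
noncomputable def binomWeight {α : Type*} (Γ : Finset α) (p : ℝ) (S : Finset α) : ℝ :=
  p ^ S.card * (1 - p) ^ (Γ.card - S.card)

open Classical in
/-- The probability that the binomial random subset `Γ_p` satisfies the property `P`. -/
noncomputable def binomProb {α : Type*} (Γ : Finset α) (p : ℝ) (P : Finset α → Prop) : ℝ :=
  ∑ S ∈ Γ.powerset, if P S then binomWeight Γ p S else 0

/-- `deg_i(v, U)`: the number of edges `e` of the hypergraph with edge set `E` such that
`v ∈ e` and `|e ∩ (U \ {v})| ≥ i`. -/
def degi {α : Type*} [DecidableEq α] (E : Finset (Finset α)) (i : ℕ) (v : α) (U : Finset α) : ℕ :=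
  (E.filter fun e => v ∈ e ∧ i ≤ (e ∩ U.erase v).card).card

/-- `μ_i(H, q)`: the expected value of `∑_{v ∈ V} deg_i(v, V_q)²` for the binomial random
subset `V_q` of the vertex set `V` of the hypergraph `H = (V, E)`. -/
noncomputable def mu {α : Type*} [DecidableEq α] (V : Finset α) (E : Finset (Finset α))
    (i : ℕ) (q : ℝ) : ℝ :=
  ∑ S ∈ V.powerset, binomWeight V q S * ∑ v ∈ V, (degi E i v S : ℝ) ^ 2

/-- A sequence of hypergraphs `(V n, E n)` is `α`-dense. -/
def AlphaDense {α : Type*} [DecidableEq α] (V : ℕ → Finset α) (E : ℕ → Finset (Finset α))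
    (a : ℝ) : Prop :=
  ∀ ε : ℝ, 0 < ε → ∃ ζ : ℝ, 0 < ζ ∧ ∃ n₀ : ℕ, ∀ n ≥ n₀, ∀ U ⊆ V n,
    (a + ε) * ((V n).card : ℝ) ≤ (U.card : ℝ) →
    ζ * ((E n).card : ℝ) ≤ (((E n).filter fun e => e ⊆ U).card : ℝ)

/-- A sequence of `k`-uniform hypergraphs `(V n, E n)` is `(K, p)`-bounded. -/
def KPBounded {α : Type*} [DecidableEq α] (k : ℕ) (V : ℕ → Finset α)
    (E : ℕ → Finset (Finset α)) (K : ℝ) (p : ℕ → ℝ) : Prop :=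
  ∀ i : ℕ, 1 ≤ i → i ≤ k - 1 → ∃ n₀ : ℕ, ∀ n ≥ n₀, ∀ q : ℝ, p n ≤ q → q ≤ 1 →
    mu (V n) (E n) i q ≤ K * q ^ (2 * i) * ((E n).card : ℝ) ^ 2 / ((V n).card : ℝ)

/-- The homothetic copies of `F` inside `[n]^ℓ`, as a family of finsets: the edge set of
the hypergraph `H_n` associated with the Furstenberg–Katznelson theorem. -/
def homCopies (l n : ℕ) (F : Finset (Fin l → ℕ)) : Finset (Finset (Fin l → ℕ)) :=
  (((Fintype.piFinset fun _ : Fin l => Finset.range (n + 1)) ×ˢ Finset.Icc 1 n).filter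
    fun yl => ∀ f ∈ F, (fun j => yl.1 j + yl.2 * f j) ∈
      Fintype.piFinset fun _ : Fin l => Finset.Icc 1 n).image
    fun yl => F.image fun f j => yl.1 j + yl.2 * f j

/-- The probability that the binomial random subset of `V` contains `B` is `q ^ |B|`. -/
theorem sum_binomWeight_superset {α : Type*} [DecidableEq α] {V B : Finset α} (hB : B ⊆ V)
    (q : ℝ) :
    ∑ S ∈ V.powerset, binomWeight V q S * (if B ⊆ S then 1 else 0) = q ^ B.card := by
  have hset : V.powerset.filter (fun S => B ⊆ S) = (V \ B).powerset.image (B ∪ ·) := by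
    rw [← Finset.Icc_eq_image_powerset hB]
    ext S
    simp [and_comm]
  have hinj : Set.InjOn (B ∪ ·) ((V \ B).powerset : Set (Finset α)) := by
    intro S hS T hT h
    simp only [Finset.coe_powerset, Set.mem_preimage, Set.mem_powerset_iff, Finset.coe_subset,
      Finset.subset_sdiff] at hS hT
    have h' := congrArg (· \ B) h
    simpa [Finset.union_sdiff_distrib, hS.2.sdiff_eq_left, hT.2.sdiff_eq_left] using h'
  simp only [mul_ite, mul_one, mul_zero]
  rw [← Finset.sum_filter, hset, Finset.sum_image hinj]
  have hterm : ∀ S ∈ (V \ B).powerset, binomWeight V q (B ∪ S) =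
      q ^ B.card * (q ^ S.card * (1 - q) ^ ((V \ B).card - S.card)) := by
    intro S hS
    rw [Finset.mem_powerset, Finset.subset_sdiff] at hS
    rw [binomWeight, Finset.card_union_of_disjoint hS.2.symm, Finset.card_sdiff_of_subset hB,
      pow_add, Nat.sub_sub, mul_assoc]
  rw [Finset.sum_congr rfl hterm, ← Finset.mul_sum, Finset.sum_pow_mul_eq_add_pow]
  simp

theorem binomWeight_nonneg {α : Type*} {V S : Finset α} {q : ℝ} (h0 : 0 ≤ q) (h1 : q ≤ 1) :
    0 ≤ binomWeight V q S :=
  mul_nonneg (pow_nonneg h0 _) (pow_nonneg (sub_nonneg.2 h1) _)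

/-- The pairs `(e, A)` with `v ∈ e ∈ E` and `A` an `i`-element subset of `e \ {v}`. -/
def rootedSubsets {α : Type*} [DecidableEq α] (E : Finset (Finset α)) (i : ℕ) (v : α) :
    Finset (Σ _ : Finset α, Finset α) :=
  (E.filter fun e => v ∈ e).sigma fun e => (e.erase v).powersetCard i

theorem degi_le_sum_rootedSubsets {α : Type*} [DecidableEq α] (E : Finset (Finset α)) (i : ℕ)
    (v : α) (S : Finset α) :
    (degi E i v S : ℝ) ≤ ∑ x ∈ rootedSubsets E i v, if x.2 ⊆ S then 1 else 0 := by
  rw [degi, rootedSubsets, Finset.sum_sigma, ← Finset.filter_filter, Finset.card_filter,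
    Nat.cast_sum]
  refine Finset.sum_le_sum fun e _ => ?_
  split_ifs with h
  · obtain ⟨A, hA, hAi⟩ := Finset.exists_subset_card_eq h
    have hAe : A ∈ (e.erase v).powersetCard i := by
      refine Finset.mem_powersetCard.2 ⟨fun a ha => ?_, hAi⟩
      have := hA ha
      simp only [Finset.mem_inter, Finset.mem_erase] at this ⊢
      tauto
    have hAS : A ⊆ S := fun a ha =>
      Finset.mem_of_mem_erase (Finset.mem_inter.1 (hA ha)).2
    refine le_trans ?_ (Finset.single_le_sum (fun B _ => by positivity) hAe)
    simp [hAS]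
  · push_cast
    exact Finset.sum_nonneg fun B _ => by positivity

theorem sum_binomWeight_degi_sq_le {α : Type*} [DecidableEq α] {V : Finset α}
    {E : Finset (Finset α)} (hE : ∀ e ∈ E, e ⊆ V) (i : ℕ) (v : α) {q : ℝ} (h0 : 0 ≤ q)
    (h1 : q ≤ 1) :
    ∑ S ∈ V.powerset, binomWeight V q S * (degi E i v S : ℝ) ^ 2 ≤
      ∑ x ∈ rootedSubsets E i v, ∑ y ∈ rootedSubsets E i v, q ^ (x.2 ∪ y.2).card := by
  have hsub : ∀ x ∈ rootedSubsets E i v, x.2 ⊆ V := by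
    intro x hx
    simp only [rootedSubsets, Finset.mem_sigma, Finset.mem_filter, Finset.mem_powersetCard] at hx
    exact hx.2.1.trans ((Finset.erase_subset _ _).trans (hE _ hx.1.1))
  have hsq : ∀ S, (degi E i v S : ℝ) ^ 2 ≤ ∑ x ∈ rootedSubsets E i v,
      ∑ y ∈ rootedSubsets E i v, if x.2 ∪ y.2 ⊆ S then 1 else 0 := by
    intro S
    refine (pow_le_pow_left₀ (Nat.cast_nonneg _) (degi_le_sum_rootedSubsets E i v S) 2).trans ?_
    rw [sq, Finset.sum_mul_sum]
    refine le_of_eq (Finset.sum_congr rfl fun x _ => Finset.sum_congr rfl fun y _ => ?_)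
    simp only [Finset.union_subset_iff, ite_and]
    split_ifs <;> simp
  calc ∑ S ∈ V.powerset, binomWeight V q S * (degi E i v S : ℝ) ^ 2
      ≤ ∑ S ∈ V.powerset, binomWeight V q S * ∑ x ∈ rootedSubsets E i v,
        ∑ y ∈ rootedSubsets E i v, (if x.2 ∪ y.2 ⊆ S then 1 else 0) :=
        Finset.sum_le_sum fun S _ =>
          mul_le_mul_of_nonneg_left (hsq S) (binomWeight_nonneg h0 h1)
    _ = ∑ x ∈ rootedSubsets E i v, ∑ y ∈ rootedSubsets E i v, ∑ S ∈ V.powerset,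
        binomWeight V q S * (if x.2 ∪ y.2 ⊆ S then 1 else 0) := by
        simp only [Finset.mul_sum]
        rw [Finset.sum_comm]
        exact Finset.sum_congr rfl fun x _ => Finset.sum_comm
    _ = _ := Finset.sum_congr rfl fun x hx => Finset.sum_congr rfl fun y hy =>
        sum_binomWeight_superset (Finset.union_subset (hsub x hx) (hsub y hy)) q

theorem card_powersetCard_erase_le {α : Type*} [DecidableEq α] {e : Finset α} {k : ℕ}
    (he : e.card ≤ k) (i : ℕ) (v : α) : ((e.erase v).powersetCard i).card ≤ 2 ^ k := by
  rw [Finset.card_powersetCard]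
  exact (Nat.choose_le_two_pow _ _).trans
    (Nat.pow_le_pow_right (by norm_num) ((Finset.card_erase_le).trans he))

theorem card_rootedSubsets_le {α : Type*} [DecidableEq α] {E : Finset (Finset α)} {k D : ℕ}
    (hk : ∀ e ∈ E, e.card ≤ k) {v : α} (hD : (E.filter fun e => v ∈ e).card ≤ D) (i : ℕ) :
    (rootedSubsets E i v).card ≤ D * 2 ^ k := by
  rw [rootedSubsets, Finset.card_sigma]
  refine (Finset.sum_le_card_nsmul _ _ (2 ^ k) fun e he =>
    card_powersetCard_erase_le (hk e (Finset.mem_filter.1 he).1) i v).trans ?_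
  exact Nat.mul_le_mul_right _ hD

theorem card_rootedSubsets_not_disjoint_le {α : Type*} [DecidableEq α] {E : Finset (Finset α)}
    {k C : ℕ} (hk : ∀ e ∈ E, e.card ≤ k) {v : α}
    (hC : ∀ w, v ≠ w → (E.filter fun e => v ∈ e ∧ w ∈ e).card ≤ C) {i : ℕ}
    {x : Σ _ : Finset α, Finset α} (hx : x ∈ rootedSubsets E i v) :
    ((rootedSubsets E i v).filter fun y => ¬ Disjoint x.2 y.2).card ≤ k * (C * 2 ^ k) := by
  simp only [rootedSubsets, Finset.mem_sigma, Finset.mem_filter, Finset.mem_powersetCard] at hx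
  have hcover : ((rootedSubsets E i v).filter fun y => ¬ Disjoint x.2 y.2) ⊆
      x.2.biUnion fun w => (E.filter fun e => v ∈ e ∧ w ∈ e).sigma
        fun e => (e.erase v).powersetCard i := by
    intro y hy
    simp only [rootedSubsets, Finset.mem_filter, Finset.mem_sigma, Finset.mem_powersetCard,
      Finset.not_disjoint_iff] at hy
    obtain ⟨⟨⟨hyE, hvy⟩, hy2, hyi⟩, w, hwx, hwy⟩ := hy
    simp only [Finset.mem_biUnion, Finset.mem_filter, Finset.mem_sigma, Finset.mem_powersetCard]
    exact ⟨w, hwx, ⟨hyE, hvy, Finset.mem_of_mem_erase (hy2 hwy)⟩, hy2, hyi⟩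
  have hx2 : x.2.card ≤ k :=
    (Finset.card_le_card (hx.2.1.trans (Finset.erase_subset _ _))).trans (hk _ hx.1.1)
  refine (Finset.card_le_card hcover).trans ((Finset.card_biUnion_le_card_mul _ _ (C * 2 ^ k)
    fun w hw => ?_).trans (Nat.mul_le_mul_right _ hx2))
  rw [Finset.card_sigma]
  refine (Finset.sum_le_card_nsmul _ _ (2 ^ k) fun e he =>
    card_powersetCard_erase_le (hk e (Finset.mem_filter.1 he).1) i v).trans ?_
  exact Nat.mul_le_mul_right _ (hC w (Finset.ne_of_mem_erase (hx.2.1 hw)).symm)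

/-- A bound on `μ_i` in terms of the maximum degree `D` and the maximum codegree `C`, valid as
soon as `q ^ i * N ≥ 1`. -/
theorem mu_le_of_degree_codegree {α : Type*} [DecidableEq α] {V : Finset α}
    {E : Finset (Finset α)} {k D C i : ℕ} {q N : ℝ} (hE : ∀ e ∈ E, e ⊆ V)
    (hk : ∀ e ∈ E, e.card ≤ k) (hD : ∀ v, (E.filter fun e => v ∈ e).card ≤ D)
    (hC : ∀ v w, v ≠ w → (E.filter fun e => v ∈ e ∧ w ∈ e).card ≤ C)
    (h0 : 0 ≤ q) (h1 : q ≤ 1) (hN : 1 ≤ q ^ i * N) :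
    mu V E i q ≤ V.card * (q ^ (2 * i) * (4 ^ k * (D ^ 2 + N * D * k * C))) := by
  have hN0 : 0 ≤ N := by
    by_contra! h
    have := mul_nonpos_of_nonneg_of_nonpos (pow_nonneg h0 i) h.le
    linarith
  have hterm : ∀ v, ∀ x ∈ rootedSubsets E i v, ∀ y ∈ rootedSubsets E i v,
      q ^ (x.2 ∪ y.2).card ≤ q ^ (2 * i) * (1 + N * if ¬ Disjoint x.2 y.2 then 1 else 0) := by
    intro v x hx y hy
    simp only [rootedSubsets, Finset.mem_sigma, Finset.mem_powersetCard] at hx hy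
    by_cases h : Disjoint x.2 y.2
    · rw [Finset.card_union_of_disjoint h, hx.2.2, hy.2.2]
      simp [h, two_mul]
    · have hi : i ≤ (x.2 ∪ y.2).card := by
        rw [← hx.2.2]
        exact Finset.card_le_card Finset.subset_union_left
      have hq := pow_nonneg h0 i
      calc q ^ (x.2 ∪ y.2).card ≤ q ^ i := pow_le_pow_of_le_one h0 h1 hi
        _ ≤ q ^ i * (q ^ i * N) := le_mul_of_one_le_right hq hN
        _ ≤ q ^ (2 * i) * (1 + N * 1) := by
          rw [two_mul, pow_add]
          nlinarith [mul_nonneg hq hq]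
        _ = _ := by simp [h]
  have hvertex : ∀ v ∈ V, ∑ S ∈ V.powerset, binomWeight V q S * (degi E i v S : ℝ) ^ 2 ≤
      q ^ (2 * i) * (4 ^ k * (D ^ 2 + N * D * k * C)) := by
    intro v _
    have hT : ((rootedSubsets E i v).card : ℝ) ≤ D * 2 ^ k := by
      exact_mod_cast card_rootedSubsets_le hk (hD v) i
    have hinner : ∀ x ∈ rootedSubsets E i v,
        ∑ y ∈ rootedSubsets E i v, q ^ (x.2 ∪ y.2).card ≤
          q ^ (2 * i) * (D * 2 ^ k + N * (k * (C * 2 ^ k))) := by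
      intro x hx
      have hnd : (((rootedSubsets E i v).filter fun y => ¬ Disjoint x.2 y.2).card : ℝ) ≤
          k * (C * 2 ^ k) := by
        exact_mod_cast card_rootedSubsets_not_disjoint_le hk (hC v) hx
      refine (Finset.sum_le_sum fun y hy => hterm v x hx y hy).trans ?_
      rw [← Finset.mul_sum, Finset.sum_add_distrib, ← Finset.mul_sum, Finset.sum_boole]
      simp only [Finset.sum_const, nsmul_eq_mul, mul_one]
      gcongr
    refine (sum_binomWeight_degi_sq_le hE i v h0 h1).trans
      ((Finset.sum_le_card_nsmul _ _ _ hinner).trans ?_)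
    rw [nsmul_eq_mul]
    calc ((rootedSubsets E i v).card : ℝ) *
          (q ^ (2 * i) * (D * 2 ^ k + N * (k * (C * 2 ^ k))))
        ≤ (D * 2 ^ k) * (q ^ (2 * i) * (D * 2 ^ k + N * (k * (C * 2 ^ k)))) := by
          gcongr
      _ = _ := by
          rw [show (4 : ℝ) = 2 * 2 by norm_num, mul_pow]
          ring
  rw [mu]
  simp only [Finset.mul_sum]
  rw [Finset.sum_comm]
  simpa only [nsmul_eq_mul] using Finset.sum_le_card_nsmul _ _ _ hvertex

/-- The pairs `(y, c)` of translation and dilation for which `y + c F` lies in `[n]^l`. -/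
def homParams (l n : ℕ) (F : Finset (Fin l → ℕ)) : Finset ((Fin l → ℕ) × ℕ) :=
  ((Fintype.piFinset fun _ : Fin l => Finset.range (n + 1)) ×ˢ Finset.Icc 1 n).filter
    fun yl => ∀ f ∈ F, (fun j => yl.1 j + yl.2 * f j) ∈
      Fintype.piFinset fun _ : Fin l => Finset.Icc 1 n

/-- The homothetic copy `y + c F`, for `p = (y, c)`. -/
def homCopy {l : ℕ} (F : Finset (Fin l → ℕ)) (p : (Fin l → ℕ) × ℕ) : Finset (Fin l → ℕ) :=
  F.image fun f j => p.1 j + p.2 * f j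

theorem homCopies_eq_image (l n : ℕ) (F : Finset (Fin l → ℕ)) :
    homCopies l n F = (homParams l n F).image (homCopy F) := rfl

theorem homothety_injective {l : ℕ} {f g : Fin l → ℕ} (hfg : f ≠ g)
    {p p' : (Fin l → ℕ) × ℕ}
    (hf : (fun j => p.1 j + p.2 * f j) = fun j => p'.1 j + p'.2 * f j)
    (hg : (fun j => p.1 j + p.2 * g j) = fun j => p'.1 j + p'.2 * g j) : p = p' := by
  obtain ⟨j, hj⟩ := Function.ne_iff.1 hfg
  have h2 : p.2 = p'.2 := by
    have h1 := congrFun hf j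
    have h2 := congrFun hg j
    zify at h1 h2 hj ⊢
    have : ((p.2 : ℤ) - p'.2) * (f j - g j) = 0 := by linear_combination h1 - h2
    rcases mul_eq_zero.1 this with h | h
    · exact sub_eq_zero.1 h
    · exact absurd (sub_eq_zero.1 h) hj
  refine Prod.ext (funext fun m => ?_) h2
  have := congrFun hf m
  simp only [h2] at this
  exact Nat.add_right_cancel this

theorem subset_of_mem_homCopies {l n : ℕ} {F e : Finset (Fin l → ℕ)}
    (he : e ∈ homCopies l n F) : e ⊆ Fintype.piFinset fun _ : Fin l => Finset.Icc 1 n := by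
  rw [homCopies_eq_image, Finset.mem_image] at he
  obtain ⟨p, hp, rfl⟩ := he
  exact Finset.image_subset_iff.2 (Finset.mem_filter.1 hp).2

theorem card_le_of_mem_homCopies {l n : ℕ} {F e : Finset (Fin l → ℕ)}
    (he : e ∈ homCopies l n F) : e.card ≤ F.card := by
  rw [homCopies_eq_image, Finset.mem_image] at he
  obtain ⟨p, -, rfl⟩ := he
  exact Finset.card_image_le

theorem card_homCopies_filter_mem_le (l n : ℕ) (F : Finset (Fin l → ℕ)) (v : Fin l → ℕ) :
    ((homCopies l n F).filter fun e => v ∈ e).card ≤ F.card * n := by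
  rw [homCopies_eq_image, Finset.filter_image]
  refine Finset.card_image_le.trans ?_
  have hcover : (homParams l n F).filter (fun p => v ∈ homCopy F p) ⊆
      F.biUnion fun f => (homParams l n F).filter
        fun p => (fun j => p.1 j + p.2 * f j) = v := by
    intro p hp
    simp only [homCopy, Finset.mem_filter, Finset.mem_image] at hp
    obtain ⟨hp, f, hf, hv⟩ := hp
    simp only [Finset.mem_biUnion, Finset.mem_filter]
    exact ⟨f, hf, hp, hv⟩
  refine (Finset.card_le_card hcover).trans (Finset.card_biUnion_le_card_mul _ _ n fun f _ => ?_)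
  have hinj : ((homParams l n F).filter fun p => (fun j => p.1 j + p.2 * f j) = v).card ≤
      (Finset.Icc 1 n).card := by
    refine Finset.card_le_card_of_injOn Prod.snd (fun p hp => ?_) fun p hp p' hp' h => ?_
    · have := (Finset.mem_filter.1 (Finset.mem_filter.1 hp).1).1
      exact (Finset.mem_product.1 this).2
    · have h1 := (Finset.mem_filter.1 hp).2.trans (Finset.mem_filter.1 hp').2.symm
      refine Prod.ext (funext fun m => ?_) h
      have := congrFun h1 m
      simp only [h] at this
      exact Nat.add_right_cancel this
  simpa using hinj

theorem card_homCopies_filter_mem_mem_le (l n : ℕ) (F : Finset (Fin l → ℕ)) {v w : Fin l → ℕ}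
    (hvw : v ≠ w) :
    ((homCopies l n F).filter fun e => v ∈ e ∧ w ∈ e).card ≤ F.card ^ 2 := by
  rw [homCopies_eq_image, Finset.filter_image]
  refine Finset.card_image_le.trans ?_
  have hcover : (homParams l n F).filter (fun p => v ∈ homCopy F p ∧ w ∈ homCopy F p) ⊆
      (F ×ˢ F).biUnion fun fg => (homParams l n F).filter fun p =>
        (fun j => p.1 j + p.2 * fg.1 j) = v ∧ (fun j => p.1 j + p.2 * fg.2 j) = w := by
    intro p hp
    simp only [homCopy, Finset.mem_filter, Finset.mem_image] at hp
    obtain ⟨hp, ⟨f, hf, hv⟩, g, hg, hw⟩ := hp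
    simp only [Finset.mem_biUnion, Finset.mem_filter, Finset.mem_product]
    exact ⟨(f, g), ⟨hf, hg⟩, hp, hv, hw⟩
  refine (Finset.card_le_card hcover).trans
    ((Finset.card_biUnion_le_card_mul _ _ 1 fun fg _ => ?_).trans ?_)
  · refine Finset.card_le_one.2 fun p hp p' hp' => ?_
    obtain ⟨-, hv, hw⟩ := Finset.mem_filter.1 hp
    obtain ⟨-, hv', hw'⟩ := Finset.mem_filter.1 hp'
    refine homothety_injective (f := fg.1) (g := fg.2) (fun h => hvw ?_) (hv.trans hv'.symm)
      (hw.trans hw'.symm)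
    rw [← hv, ← hw, h]
  · rw [Finset.card_product, mul_one, sq]

theorem card_homParams_le (l n : ℕ) {F : Finset (Fin l → ℕ)} (hF : 1 < F.card) :
    (homParams l n F).card ≤ F.card ^ 2 * (homCopies l n F).card := by
  obtain ⟨f, hf, g, hg, hfg⟩ := Finset.one_lt_card.1 hF
  rw [homCopies_eq_image]
  refine Finset.card_le_mul_card_image _ _ fun e he => ?_
  have hcard : (e ×ˢ e).card ≤ F.card ^ 2 := by
    rw [Finset.card_product, ← sq]
    exact Nat.pow_le_pow_left (card_le_of_mem_homCopies he) 2
  refine le_trans (Finset.card_le_card_of_injOn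
    (fun p => ((fun j => p.1 j + p.2 * f j), fun j => p.1 j + p.2 * g j))
    (fun p hp => ?_) fun p _ p' _ h => ?_) hcard
  · rw [← (Finset.mem_filter.1 hp).2]
    exact Finset.mem_product.2
      ⟨Finset.mem_image_of_mem _ hf, Finset.mem_image_of_mem _ hg⟩
  · exact homothety_injective hfg (Prod.ext_iff.1 h).1 (Prod.ext_iff.1 h).2

theorem pow_le_card_homParams {l n M : ℕ} {F : Finset (Fin l → ℕ)} (hM : 1 ≤ M)
    (hFM : ∀ f ∈ F, ∀ j, f j ≤ M) : (n / (2 * M)) ^ (l + 1) ≤ (homParams l n F).card := by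
  set m := n / (2 * M) with hm
  have hmn : 2 * M * m ≤ n := Nat.mul_div_le n (2 * M)
  have hsub : (Fintype.piFinset fun _ : Fin l => Finset.Icc 1 m) ×ˢ Finset.Icc 1 m ⊆
      homParams l n F := by
    rintro ⟨y, c⟩ hp
    simp only [Finset.mem_product, Fintype.mem_piFinset, Finset.mem_Icc] at hp
    obtain ⟨hy, hc1, hc⟩ := hp
    simp only [homParams, Finset.mem_filter, Finset.mem_product, Fintype.mem_piFinset,
      Finset.mem_range, Finset.mem_Icc]
    have hmM : m ≤ M * m := Nat.le_mul_of_pos_left m hM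
    refine ⟨⟨fun j => ?_, hc1, by nlinarith⟩, fun f hf j => ?_⟩
    · have := (hy j).2
      nlinarith
    · have := hy j
      have hcf : c * f j ≤ m * M := Nat.mul_le_mul hc (hFM f hf j)
      constructor <;> nlinarith
  refine le_trans (le_of_eq ?_) (Finset.card_le_card hsub)
  simp [pow_succ]

/-- The number of homothetic copies of `F` in `[n]^l` is at least of order `n ^ (l + 1)`. -/
theorem pow_le_mul_card_homCopies {l n M : ℕ} {F : Finset (Fin l → ℕ)} (hF : 1 < F.card)
    (hM : 1 ≤ M) (hFM : ∀ f ∈ F, ∀ j, f j ≤ M) (hn : 2 * M ≤ n) :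
    n ^ (l + 1) ≤ (4 * M) ^ (l + 1) * F.card ^ 2 * (homCopies l n F).card := by
  have hdiv : n ≤ 4 * M * (n / (2 * M)) := by
    have h1 : 1 ≤ n / (2 * M) := (Nat.one_le_div_iff (by omega)).2 hn
    have h2 := Nat.div_add_mod n (2 * M)
    have h3 := Nat.mod_lt n (show 0 < 2 * M by omega)
    nlinarith
  calc n ^ (l + 1) ≤ (4 * M * (n / (2 * M))) ^ (l + 1) := Nat.pow_le_pow_left hdiv _
    _ = (4 * M) ^ (l + 1) * (n / (2 * M)) ^ (l + 1) := mul_pow _ _ _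
    _ ≤ (4 * M) ^ (l + 1) * (F.card ^ 2 * (homCopies l n F).card) :=
        Nat.mul_le_mul_left _ ((pow_le_card_homParams hM hFM).trans (card_homParams_le l n hF))
    _ = _ := (mul_assoc _ _ _).symm

theorem one_le_pow_mul_of_rpow_le {k i n : ℕ} {q : ℝ} (hk : 2 ≤ k) (hi : i ≤ k - 1) (hn : 1 ≤ n)
    (hq : (n : ℝ) ^ (-(1 : ℝ) / ((k : ℝ) - 1)) ≤ q) (h1 : q ≤ 1) : 1 ≤ q ^ i * (n : ℝ) := by
  have hn0 : (0 : ℝ) < n := by exact_mod_cast hn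
  have hq0 : 0 ≤ q := (Real.rpow_nonneg hn0.le _).trans hq
  have hcast : ((k - 1 : ℕ) : ℝ) = (k : ℝ) - 1 := by
    rw [Nat.cast_sub (by omega), Nat.cast_one]
  have hne : (k : ℝ) - 1 ≠ 0 := by
    rw [← hcast]
    exact_mod_cast (show k - 1 ≠ 0 by omega)
  have hpow : (n : ℝ)⁻¹ ≤ q ^ i := by
    calc (n : ℝ)⁻¹ = ((n : ℝ) ^ (-(1 : ℝ) / ((k : ℝ) - 1))) ^ (k - 1) := by
          rw [← Real.rpow_natCast, ← Real.rpow_mul hn0.le, hcast, div_mul_cancel₀ _ hne,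
            Real.rpow_neg_one]
      _ ≤ q ^ (k - 1) := pow_le_pow_left₀ (Real.rpow_nonneg hn0.le _) hq _
      _ ≤ q ^ i := pow_le_pow_of_le_one hq0 h1 hi
  calc (1 : ℝ) = (n : ℝ)⁻¹ * n := (inv_mul_cancel₀ hn0.ne').symm
    _ ≤ q ^ i * n := mul_le_mul_of_nonneg_right hpow hn0.le

theorem mu_homCopies_le {l n i : ℕ} {F : Finset (Fin l → ℕ)} (hF : 2 ≤ F.card)
    (hi : i ≤ F.card - 1) (hn : 1 ≤ n) {q : ℝ}
    (hq : (n : ℝ) ^ (-(1 : ℝ) / ((F.card : ℝ) - 1)) ≤ q) (h1 : q ≤ 1) :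
    mu (Fintype.piFinset fun _ : Fin l => Finset.Icc 1 n) (homCopies l n F) i q ≤
      (4 ^ F.card * ((F.card : ℝ) ^ 2 + (F.card : ℝ) ^ 4)) * q ^ (2 * i) * (n : ℝ) ^ (l + 2) := by
  have hq0 : 0 ≤ q := (Real.rpow_nonneg (Nat.cast_nonneg n) _).trans hq
  refine (mu_le_of_degree_codegree (fun _ => subset_of_mem_homCopies)
    (fun _ => card_le_of_mem_homCopies) (card_homCopies_filter_mem_le l n F)
    (fun _ _ => card_homCopies_filter_mem_mem_le l n F) hq0 h1
    (one_le_pow_mul_of_rpow_le hF hi hn hq h1)).trans (le_of_eq ?_)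
  simp only [Fintype.card_piFinset, Nat.card_Icc, Finset.prod_const, Finset.card_univ,
    Fintype.card_fin, Nat.add_sub_cancel]
  push_cast
  ring

/-- The hypergraph of homothetic copies of `F` in `[n]^ℓ` satisfies the degree-square
expectation bound `μ_i(H_n, q) ≤ K q^{2i} n^{ℓ+2}`, and the sequence `(H_n)` is
`(K, (n^{-1/(k-1)}))`-bounded. -/
theorem homothetic_hypergraph_bounded (l : ℕ) (hl : 1 ≤ l) (F : Finset (Fin l → ℕ))
    (hF : 3 ≤ F.card) :
    (∀ i : ℕ, 1 ≤ i → i ≤ F.card - 1 → ∃ K : ℝ, ∃ n₀ : ℕ, ∀ n ≥ n₀, ∀ q : ℝ,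
      (n : ℝ) ^ (-(1 : ℝ) / ((F.card : ℝ) - 1)) ≤ q → q ≤ 1 →
      mu (Fintype.piFinset fun _ : Fin l => Finset.Icc 1 n) (homCopies l n F) i q ≤
        K * q ^ (2 * i) * (n : ℝ) ^ (l + 2)) ∧
    ∃ K : ℝ, 1 ≤ K ∧
      KPBounded F.card (fun n => Fintype.piFinset fun _ : Fin l => Finset.Icc 1 n)
        (fun n => homCopies l n F) K
        (fun n => (n : ℝ) ^ (-(1 : ℝ) / ((F.card : ℝ) - 1))) := by
  have hF2 : 2 ≤ F.card := by omega
  refine ⟨fun i _ hi => ⟨_, 1, fun n hn q hq h1 => mu_homCopies_le hF2 hi hn hq h1⟩, ?_⟩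
  obtain ⟨M, hM, hFM⟩ : ∃ M : ℕ, 1 ≤ M ∧ ∀ f ∈ F, ∀ j, f j ≤ M := by
    refine ⟨1 + ∑ f ∈ F, ∑ j, f j, by omega, fun f hf j => ?_⟩
    have h1 := Finset.single_le_sum (f := f) (fun _ _ => Nat.zero_le _) (Finset.mem_univ j)
    have h2 := Finset.single_le_sum (f := fun f : Fin l → ℕ => ∑ j, f j)
      (fun _ _ => Nat.zero_le _) hf
    omega
  set A : ℝ := 4 ^ F.card * ((F.card : ℝ) ^ 2 + (F.card : ℝ) ^ 4)
  set B : ℝ := (4 * M) ^ (l + 1) * (F.card : ℝ) ^ 2 with hB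
  have hk1 : (1 : ℝ) ≤ F.card := by exact_mod_cast (show 1 ≤ F.card by omega)
  have hM1 : (1 : ℝ) ≤ M := by exact_mod_cast hM
  have hA1 : 1 ≤ A := by
    have h2 := one_le_pow₀ hk1 (n := 2)
    have h4 := one_le_pow₀ hk1 (n := 4)
    exact one_le_mul_of_one_le_of_one_le (one_le_pow₀ (by norm_num)) (by linarith)
  have hB1 : 1 ≤ B :=
    one_le_mul_of_one_le_of_one_le (one_le_pow₀ (by linarith)) (one_le_pow₀ hk1)
  refine ⟨A * B ^ 2, one_le_mul_of_one_le_of_one_le hA1 (one_le_pow₀ hB1), fun i _ hi =>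
    ⟨2 * M, fun n hn q hq h1 => ?_⟩⟩
  have hn1 : 1 ≤ n := by omega
  have hn0 : (0 : ℝ) < n := by exact_mod_cast hn1
  have hq0 : 0 ≤ q := (Real.rpow_nonneg hn0.le _).trans hq
  have hcard : (n : ℝ) ^ (l + 1) ≤ B * (homCopies l n F).card := by
    rw [hB]
    exact_mod_cast pow_le_mul_card_homCopies (show 1 < F.card by omega) hM hFM hn
  have hsq := pow_le_pow_left₀ (by positivity) hcard 2
  refine (mu_homCopies_le hF2 hi hn1 hq h1).trans ?_
  simp only [Fintype.card_piFinset, Nat.card_Icc, Finset.prod_const, Finset.card_univ,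
    Fintype.card_fin, Nat.add_sub_cancel, Nat.cast_pow]
  rw [le_div_iff₀ (by positivity)]
  calc A * q ^ (2 * i) * (n : ℝ) ^ (l + 2) * (n : ℝ) ^ l
      = A * q ^ (2 * i) * ((n : ℝ) ^ (l + 1)) ^ 2 := by ring
    _ ≤ A * q ^ (2 * i) * (B * (homCopies l n F).card) ^ 2 := by gcongr
    _ = _ := by ring
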